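/- arXiv:0912.1506 — 6 statements merged into one kernel-verified Lean document; each statement's English description precedes it below -/
import Mathlib

section
/- The action on the 2-torus 𝕋² = (ℝ/ℤ)² of the free subgroup of SL₂(ℤ) generated by the matrices A = [[1,2],[0,1]] and B = [[1,0],[2,1]] is ergodic with respect to the Haar (Lebesgue) probability measure: every measurable set E ⊆ 𝕋² that is invariant up to null sets under the toral automorphisms induced by A and by B has measure 0 or 1. -/
open MeasureTheory

/-- The 2-torus `𝕋² = (ℝ/ℤ)²` with its Haar (Lebesgue) probability measure `volume`. -/
abbrev Torus2 := UnitAddCircle × UnitAddCircle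

/-- The toral automorphism `(x, y) ↦ (x + k·y, y)` given by the matrix `[[1,k],[0,1]]`. -/
noncomputable def shearX (k : ℤ) : Equiv.Perm Torus2 where
  toFun p := (p.1 + k • p.2, p.2)
  invFun p := (p.1 - k • p.2, p.2)
  left_inv p := by simp
  right_inv p := by simp

/-- The toral automorphism `(x, y) ↦ (x, y + k·x)` given by the matrix `[[1,0],[k,1]]`. -/
noncomputable def shearY (k : ℤ) : Equiv.Perm Torus2 where
  toFun p := (p.1, p.2 + k • p.1)
  invFun p := (p.1, p.2 - k • p.1)
  left_inv p := by simp
  right_inv p := by simp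

/-- The toral automorphism of `𝕋²` induced by `A = [[1,2],[0,1]] ∈ SL₂(ℤ)` by matrix
multiplication: `(x, y) ↦ (x + 2y, y)`. -/
noncomputable def TA : Equiv.Perm Torus2 := shearX 2

/-- The toral automorphism of `𝕋²` induced by `B = [[1,0],[2,1]] ∈ SL₂(ℤ)` by matrix
multiplication: `(x, y) ↦ (x, 2x + y)`. -/
noncomputable def TB : Equiv.Perm Torus2 := shearY 2

theorem AddCircle.ae_addOrderOf_eq_zero (p : ℝ) [Fact (0 < p)] :
    ∀ᵐ x : AddCircle p, addOrderOf x = 0 := by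
  have hfin : {x : AddCircle p | addOrderOf x ≠ 0} =
      ⋃ n : ℕ, {x : AddCircle p | addOrderOf x = n + 1} := by
    ext x
    simp only [Set.mem_ofPred_eq, Set.mem_iUnion]
    exact ⟨Nat.exists_eq_succ_of_ne_zero, fun ⟨n, hn⟩ => hn ▸ n.succ_ne_zero⟩
  have : NullSingletonClass (volume : Measure (AddCircle p)) :=
    ⟨fun x => by
      rw [← Metric.closedBall_zero, AddCircle.volume_closedBall]
      simp⟩
  have hc : {x : AddCircle p | addOrderOf x ≠ 0}.Countable := by
    rw [hfin]
    exact Set.countable_iUnion fun n =>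
      (AddCircle.finite_setOfPred_addOrderOf_eq p n.succ_pos).countable
  exact hc.measure_zero volume

/-- A subset of the torus that is almost invariant under a nontrivial vertical shear agrees almost
everywhere with a union of vertical circles. -/
theorem exists_ae_eq_prod_univ_of_shearY {k : ℤ} (hk : k ≠ 0) {E : Set Torus2}
    (hE : MeasurableSet E) (h : (shearY k : Torus2 → Torus2) ⁻¹' E =ᵐ[volume] E) :
    ∃ G : Set UnitAddCircle, MeasurableSet G ∧ E =ᵐ[volume] G ×ˢ Set.univ := by
  have hG : MeasurableSet {x : UnitAddCircle | volume (Prod.mk x ⁻¹' E) = 1} :=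
    measurable_measure_prodMk_left hE (measurableSet_singleton 1)
  refine ⟨_, hG, Filter.eventuallyEq_set.2 ?_⟩
  refine (Measure.ae_prod_mem_iff_ae_ae_mem (hE.iff (hG.prod MeasurableSet.univ))).2 ?_
  filter_upwards [AddCircle.ae_addOrderOf_eq_zero 1,
    Measure.ae_ae_of_ae_prod (Filter.eventuallyEq_set.1 h)] with x hx hinv
  have hkx : addOrderOf (k • x) = 0 := by
    rw [addOrderOf_eq_zero_iff] at hx ⊢
    intro hfin
    obtain ⟨n, hn, hnk⟩ := isOfFinAddOrder_iff_zsmul_eq_zero.1 hfin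
    exact hx (isOfFinAddOrder_iff_zsmul_eq_zero.2 ⟨n * k, mul_ne_zero hn hk, by rwa [mul_zsmul]⟩)
  have herg := AddCircle.ergodic_add_right.2 hkx
  rcases herg.quasiErgodic.ae_empty_or_univ₀
    (hE.preimage measurable_prodMk_left).nullMeasurableSet
    (Filter.eventuallyEq_set.2 hinv) with h0 | h1
  · have hm : volume (Prod.mk x ⁻¹' E) = 0 := by simpa using measure_congr h0
    filter_upwards [Filter.eventuallyEq_set.1 h0] with y hy
    exact iff_of_false hy.1 fun hxy => zero_ne_one (hm.symm.trans hxy.1)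
  · have hm : volume (Prod.mk x ⁻¹' E) = 1 := by simpa using measure_congr h1
    filter_upwards [Filter.eventuallyEq_set.1 h1] with y hy
    exact iff_of_true (hy.2 trivial) ⟨hm, trivial⟩

/-- A subset of the torus that is almost invariant under a nontrivial horizontal shear agrees almost
everywhere with a union of horizontal circles. -/
theorem exists_ae_eq_univ_prod_of_shearX {k : ℤ} (hk : k ≠ 0) {E : Set Torus2}
    (hE : MeasurableSet E) (h : (shearX k : Torus2 → Torus2) ⁻¹' E =ᵐ[volume] E) :
    ∃ F : Set UnitAddCircle, MeasurableSet F ∧ E =ᵐ[volume] Set.univ ×ˢ F := by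
  have hswap : MeasurePreserving (Prod.swap : Torus2 → Torus2) volume volume :=
    Measure.measurePreserving_swap
  obtain ⟨F, hF, hEF⟩ := exists_ae_eq_prod_univ_of_shearY hk (hE.preimage measurable_swap)
    (hswap.quasiMeasurePreserving.preimage_ae_eq h)
  refine ⟨F, hF, ?_⟩
  have hEF' := hswap.quasiMeasurePreserving.preimage_ae_eq hEF
  rwa [Set.preimage_swap_prod, ← Set.preimage_comp, Prod.swap_swap_eq, Set.preimage_id] at hEF'

/-- The action on `𝕋²` of the free subgroup of `SL₂(ℤ)` generated by `A = [[1,2],[0,1]]`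
and `B = [[1,0],[2,1]]` is ergodic for the Haar probability measure: any measurable set
invariant up to null sets under the automorphisms induced by `A` and `B` has measure
`0` or `1`. -/
theorem ergodic_of_F2_subgroup_of_SL2Z_on_torus (E : Set Torus2) (hE : MeasurableSet E)
    (hA : volume (symmDiff ((TA : Torus2 → Torus2) ⁻¹' E) E) = 0)
    (hB : volume (symmDiff ((TB : Torus2 → Torus2) ⁻¹' E) E) = 0) :
    volume E = 0 ∨ volume E = 1 := by
  obtain ⟨F, hF, hEF⟩ := exists_ae_eq_univ_prod_of_shearX two_ne_zero hE
    (measure_symmDiff_eq_zero_iff.1 hA)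
  obtain ⟨G, hG, hEG⟩ := exists_ae_eq_prod_univ_of_shearY two_ne_zero hE
    (measure_symmDiff_eq_zero_iff.1 hB)
  have hvF : volume E = volume F := by
    rw [measure_congr hEF, Measure.volume_eq_prod, Measure.prod_prod]
    simp
  have hvG : volume E = volume G := by
    rw [measure_congr hEG, Measure.volume_eq_prod, Measure.prod_prod]
    simp
  have hEGF : E =ᵐ[volume] G ×ˢ F := by
    simpa [Set.prod_inter_prod] using hEG.inter hEF
  have hsq : volume E * volume E = volume E := by
    nth_rewrite 3 [measure_congr hEGF]
    rw [Measure.volume_eq_prod, Measure.prod_prod, ← Measure.volume_eq_prod, ← hvG, ← hvF]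
  by_cases h0 : volume E = 0
  · exact Or.inl h0
  · exact Or.inr ((ENNReal.mul_eq_left h0 (measure_ne_top _ _)).1 hsq)
end

section
/- Let (X,μ) be a standard Borel probability space, let P be a measure-preserving transformation of X, and let K > 0 be such that μ({x : P(x) ≠ x}) > K. Then there exist finitely many pairwise disjoint measurable sets E₁,…,E_m ⊆ X and δ > 0 such that every measure-preserving transformation S of X satisfying μ(P(E_l) Δ S(E_l)) < δ for all l ≤ m also satisfies μ({x : S(x) ≠ x}) > K. -/
open MeasureTheory

/-- `S` is a measure-preserving transformation of `(X, μ)`: a bimeasurable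
bijection preserving `μ`. -/
def IsMpt {X : Type*} [MeasurableSpace X] (μ : Measure X) (S : Equiv.Perm X) : Prop :=
  Measurable S ∧ Measurable S.symm ∧ MeasurePreserving S μ μ

/-- The set of points moved by a measurable permutation is a countable disjoint union of
measurable sets, each disjoint from its image. -/
theorem exists_iUnion_eq_setOf_ne_of_measurable
    {X : Type*} [TopologicalSpace X] [SecondCountableTopology X] [T2Space X]
    [MeasurableSpace X] [BorelSpace X] (P : Equiv.Perm X) (hP : Measurable P) :
    ∃ A : ℕ → Set X, (∀ n, MeasurableSet (A n)) ∧ Pairwise (Function.onFun Disjoint A) ∧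
      (∀ n, Disjoint (A n) (P '' A n)) ∧ ⋃ n, A n = {x | P x ≠ x} := by
  let B := TopologicalSpace.countableBasis X
  have hB : TopologicalSpace.IsTopologicalBasis B := TopologicalSpace.isBasis_countableBasis X
  let ι := {p : B × B // Disjoint (p.1 : Set X) (p.2 : Set X)}
  have : Countable B := (TopologicalSpace.countable_countableBasis X).to_subtype
  have : Encodable ι := Encodable.ofCountable ι
  let f : ι → Set X := fun p => p.1.1 ∩ P ⁻¹' p.1.2
  let g : ℕ → Set X := fun n => ⋃ i ∈ Encodable.decode₂ ι n, f i
  have hg (n : ℕ) : MeasurableSet (g n) ∧ Disjoint (g n) (P '' g n) := by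
    refine Encodable.iUnion_decode₂_cases (f := f)
      (C := fun A => MeasurableSet A ∧ Disjoint A (P '' A)) (by simp) fun p => ⟨?_, ?_⟩
    · exact (hB.isOpen p.1.1.2).measurableSet.inter (hP (hB.isOpen p.1.2.2).measurableSet)
    · refine p.2.mono Set.inter_subset_left ?_
      exact (Set.image_mono Set.inter_subset_right).trans (Set.image_preimage_subset _ _)
  refine ⟨disjointed g, fun n => .disjointed (fun i => (hg i).1) n, disjoint_disjointed g,
    fun n => (hg n).2.mono (disjointed_subset g n) (Set.image_mono (disjointed_subset g n)), ?_⟩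
  rw [iUnion_disjointed]
  apply Set.Subset.antisymm
  · refine Set.iUnion_subset fun n x hx h => ?_
    exact Set.disjoint_left.1 (hg n).2 hx ⟨x, hx, h⟩
  · intro x hx
    obtain ⟨U, V, hU, hV, hxU, hxV, hUV⟩ := t2_separation (Ne.symm hx)
    obtain ⟨U', hU', hxU', hUU'⟩ := hB.exists_subset_of_mem_open hxU hU
    obtain ⟨V', hV', hxV', hVV'⟩ := hB.exists_subset_of_mem_open hxV hV
    change x ∈ ⋃ n, ⋃ i ∈ Encodable.decode₂ ι n, f i
    rw [Encodable.iUnion_decode₂]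
    exact Set.mem_iUnion.2 ⟨⟨(⟨U', hU'⟩, ⟨V', hV'⟩), hUV.mono hUU' hVV'⟩, hxU', hxV'⟩

/-- If `μ({x : P x ≠ x}) > K > 0`, then there are finitely many pairwise disjoint
measurable sets `E₁, …, E_m` and `δ > 0` such that every m.p. transformation `S` with
`μ(P(E_l) Δ S(E_l)) < δ` for all `l` also satisfies `μ({x : S x ≠ x}) > K`. -/
theorem openness_of_large_support
    {X : Type} [TopologicalSpace X] [PolishSpace X] [MeasurableSpace X] [BorelSpace X]
    (μ : Measure X) [IsProbabilityMeasure μ]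
    (P : Equiv.Perm X) (hP : IsMpt μ P)
    (K : ℝ) (hK : 0 < K) (hPK : μ {x | P x ≠ x} > ENNReal.ofReal K) :
    ∃ (m : ℕ) (E : Fin m → Set X) (δ : ℝ), 0 < δ ∧
      (∀ l, MeasurableSet (E l)) ∧
      (∀ l l', l ≠ l' → Disjoint (E l) (E l')) ∧
      ∀ S : Equiv.Perm X, IsMpt μ S →
        (∀ l, μ (symmDiff ((P : X → X) '' E l) ((S : X → X) '' E l)) < ENNReal.ofReal δ) →
        μ {x | S x ≠ x} > ENNReal.ofReal K := by
  obtain ⟨A, hAm, hAd, hAP, hAU⟩ := exists_iUnion_eq_setOf_ne_of_measurable P hP.1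
  obtain ⟨m, hm⟩ : ∃ m, ENNReal.ofReal K < μ (⋃ l : Fin m, A l) := by
    have h := tendsto_measure_iUnion_accumulate (μ := μ) (f := A)
    rw [hAU] at h
    obtain ⟨n, hn⟩ := (h.eventually (lt_mem_nhds hPK)).exists
    refine ⟨n + 1, hn.trans_le (measure_mono fun x hx => ?_)⟩
    obtain ⟨k, hk, hxk⟩ := Set.mem_accumulate.1 hx
    exact Set.mem_iUnion.2 ⟨⟨k, Nat.lt_succ_of_le hk⟩, hxk⟩
  set r := (μ (⋃ l : Fin m, A l)).toReal with hr
  have hr' : μ (⋃ l : Fin m, A l) = ENNReal.ofReal r :=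
    (ENNReal.ofReal_toReal (measure_ne_top _ _)).symm
  have hKr : K < r := (ENNReal.ofReal_lt_iff_lt_toReal hK.le (measure_ne_top _ _)).1 hm
  have hδ : 0 < (r - K) / (m + 1) := div_pos (sub_pos.2 hKr) (by positivity)
  refine ⟨m, fun l => A l, (r - K) / (m + 1), hδ, fun l => hAm l,
    fun l l' h => hAd (Fin.val_injective.ne h), fun S _ hS => ?_⟩
  by_contra! hSK
  have hsub : ⋃ l : Fin m, A l ⊆
      {x | S x ≠ x} ∪ ⋃ l : Fin m, symmDiff (P '' A l) (S '' A l) := by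
    refine Set.iUnion_subset fun l x hx => ?_
    by_cases h : S x = x
    · exact .inr (Set.mem_iUnion.2
        ⟨l, .inr ⟨⟨x, hx, h⟩, Set.disjoint_left.1 (hAP l) hx⟩⟩)
    · exact .inl h
  have hle : ENNReal.ofReal r ≤ ENNReal.ofReal (K + m * ((r - K) / (m + 1))) := by
    calc ENNReal.ofReal r
        ≤ μ {x | S x ≠ x} + ∑ l : Fin m, μ (symmDiff (P '' A l) (S '' A l)) := by
          rw [← hr']
          refine (measure_mono hsub).trans ((measure_union_le _ _).trans ?_)
          gcongr
          exact measure_iUnion_fintype_le _ _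
      _ ≤ ENNReal.ofReal K + ∑ _l : Fin m, ENNReal.ofReal ((r - K) / (m + 1)) := by
          gcongr with l
          exact (hS l).le
      _ = ENNReal.ofReal (K + m * ((r - K) / (m + 1))) := by
          rw [ENNReal.ofReal_add hK.le (by positivity), ENNReal.ofReal_mul (by positivity)]
          simp
  have hle' := (ENNReal.ofReal_le_ofReal_iff (by positivity)).1 hle
  have : (m + 1) * ((r - K) / (m + 1)) = r - K := by field_simp
  linarith
end

section
/- Let X be a Polish space with a Borel probability measure μ, let T₁,…,T_n : X → X be Borel measurable functions, and let K > 0 be such that μ({x : T_i(x) ≠ T_j(x) whenever i ≠ j}) > K. Then there exist finitely many pairwise disjoint Borel sets E₁,…,E_m ⊆ X, each of positive measure, such that μ(E₁ ∪ … ∪ E_m) > K and T_i(E_l) ∩ T_j(E_l) = ∅ for all i ≠ j and all l ≤ m. -/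
open MeasureTheory

/-- Given countably many measurable sets whose union has measure larger than `c`, there are
finitely many disjoint non-null measurable sets, each contained in one of the given sets, whose
union has measure larger than `c`. -/
theorem exists_fin_disjoint_refinement {X ι : Type*} [MeasurableSpace X] [Countable ι]
    (μ : Measure X) (P : ι → Set X) (hP : ∀ s, MeasurableSet (P s)) (c : ENNReal)
    (hc : c < μ (⋃ s, P s)) :
    ∃ (m : ℕ) (E : Fin m → Set X),
      (∀ l, MeasurableSet (E l)) ∧ (∀ l, 0 < μ (E l)) ∧
      (∀ l l', l ≠ l' → Disjoint (E l) (E l')) ∧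
      c < μ (⋃ l, E l) ∧ ∀ l, ∃ s, E l ⊆ P s := by
  classical
  have : Nonempty ι := by
    by_contra h
    rw [not_nonempty_iff] at h
    simp at hc
  obtain ⟨e, he⟩ := exists_surjective_nat ι
  set D : ℕ → Set X := disjointed (P ∘ e) with hD
  have hDm (k : ℕ) : MeasurableSet (D k) := MeasurableSet.disjointed (fun k => hP (e k)) k
  have hDU : ⋃ k, D k = ⋃ s, P s := by
    rw [hD, iUnion_disjointed]
    exact he.iUnion_comp P
  have hDd : Pairwise (Function.onFun Disjoint D) := disjoint_disjointed _
  rw [← hDU, measure_iUnion hDd hDm, ENNReal.tsum_eq_iSup_sum, lt_iSup_iff] at hc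
  obtain ⟨F, hF⟩ := hc
  let G := F.filter fun k => 0 < μ (D k)
  have hsum : ∑ k ∈ G, μ (D k) = ∑ k ∈ F, μ (D k) :=
    Finset.sum_filter_of_ne fun k _ hk => pos_iff_ne_zero.2 hk
  let g : Fin G.card ≃ G := G.equivFin.symm
  refine ⟨G.card, fun l => D (g l), fun l => hDm _, fun l => (Finset.mem_filter.1 (g l).2).2,
    fun l l' h => hDd fun h' => h (g.injective (Subtype.ext h')), ?_,
    fun l => ⟨e (g l), disjointed_subset _ _⟩⟩
  have hU : ⋃ l, D (g l) = ⋃ k ∈ G, D k := by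
    rw [g.surjective.iUnion_comp fun k : G => D k, Set.iUnion_subtype]
  rw [hU, measure_biUnion_finset (fun a _ b _ h => hDd h) fun k _ => hDm k, hsum]
  exact hF

/-- Distinct points indexed by a finite type have disjoint neighbourhoods in any given basis. -/
theorem TopologicalSpace.IsTopologicalBasis.exists_disjoint_of_injective {X ι : Type*}
    [TopologicalSpace X] [T2Space X] [Finite ι] {B : Set (Set X)}
    (hB : TopologicalSpace.IsTopologicalBasis B) {y : ι → X} (hy : Function.Injective y) :
    ∃ s : ι → B, (∀ i, y i ∈ (s i : Set X)) ∧
      ∀ i j, i ≠ j → Disjoint (s i : Set X) (s j) := by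
  obtain ⟨U, hU, hd⟩ := (Set.finite_range y).t2_separation
  choose V hVB hV hVU using fun i => hB.exists_subset_of_mem_open (hU (y i)).1 (hU (y i)).2
  exact ⟨fun i => ⟨V i, hVB i⟩, hV, fun i j h =>
    (hd ⟨i, rfl⟩ ⟨j, rfl⟩ (hy.ne h)).mono (hVU i) (hVU j)⟩

/-- Lemma 2: if `T₁, …, T_n` are Borel maps on a Polish probability space and the set
where they are pairwise distinct has measure `> K`, then there are finitely many
pairwise disjoint non-null Borel sets `E₁, …, E_m` with `μ(⋃ E_l) > K` such that
`T_i(E_l) ∩ T_j(E_l) = ∅` whenever `i ≠ j`. -/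
theorem exists_disjointifying_sets
    {X : Type} [TopologicalSpace X] [PolishSpace X] [MeasurableSpace X] [BorelSpace X]
    (μ : Measure X) [IsProbabilityMeasure μ]
    (n : ℕ) (T : Fin n → X → X) (hT : ∀ i, Measurable (T i))
    (K : ℝ) (hK : 0 < K)
    (hbig : μ {x | ∀ i j : Fin n, i ≠ j → T i x ≠ T j x} > ENNReal.ofReal K) :
    ∃ (m : ℕ) (E : Fin m → Set X),
      (∀ l, MeasurableSet (E l)) ∧
      (∀ l, 0 < μ (E l)) ∧
      (∀ l l', l ≠ l' → Disjoint (E l) (E l')) ∧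
      μ (⋃ l, E l) > ENNReal.ofReal K ∧
      (∀ l, ∀ i j : Fin n, i ≠ j → Disjoint (T i '' E l) (T j '' E l)) := by
  have hB := TopologicalSpace.isBasis_countableBasis X
  have : Countable (TopologicalSpace.countableBasis X) :=
    (TopologicalSpace.countable_countableBasis X).to_subtype
  let ι := {s : Fin n → TopologicalSpace.countableBasis X //
    ∀ i j, i ≠ j → Disjoint (s i : Set X) (s j)}
  let P : ι → Set X := fun s => ⋂ i, T i ⁻¹' (s.1 i : Set X)
  have hP (s : ι) : MeasurableSet (P s) :=
    MeasurableSet.iInter fun i => hT i (hB.isOpen (s.1 i).2).measurableSet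
  have hcover : {x | ∀ i j : Fin n, i ≠ j → T i x ≠ T j x} ⊆ ⋃ s, P s := by
    intro x hx
    have hinj : Function.Injective fun i => T i x := fun i j h => by
      by_contra hij
      exact hx i j hij h
    obtain ⟨s, hs, hd⟩ := hB.exists_disjoint_of_injective hinj
    exact Set.mem_iUnion.2 ⟨⟨s, hd⟩, Set.mem_iInter.2 hs⟩
  obtain ⟨m, E, hm, hpos, hdisj, hbig', hsub⟩ :=
    exists_fin_disjoint_refinement μ P hP _ (lt_of_lt_of_le hbig (measure_mono hcover))
  refine ⟨m, E, hm, hpos, hdisj, hbig', fun l i j hij => ?_⟩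
  obtain ⟨s, hs⟩ := hsub l
  have himage (k : Fin n) : T k '' E l ⊆ (s.1 k : Set X) :=
    Set.image_subset_iff.2 fun x hx => Set.mem_iInter.1 (hs hx) k
  exact (s.2 i j hij).mono (himage i) (himage j)
end

section
/- Let G be a countable group acting ergodically by measure-preserving transformations on a standard Borel probability space (X,μ), and let A, A′ ⊆ X be measurable sets with μ(A) = μ(A′) > 0. Then there is a measurable bijection φ from a conull subset of A onto a conull subset of A′ which is measure preserving (μ(φ⁻¹(B)) = μ(B) for every measurable B ⊆ A′) and whose graph is contained in E_G, i.e., φ(x) lies in the G-orbit of x for almost every x ∈ A. -/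
open MeasureTheory

/-- An action of `Γ` on `(X, μ)` is ergodic if every measurable set invariant up to
null sets under every element of `Γ` has measure `0` or `1`. -/
def ErgodicAction {X Γ : Type*} [MeasurableSpace X] [Group Γ] (μ : Measure X)
    (a : Γ →* Equiv.Perm X) : Prop :=
  ∀ A : Set X, MeasurableSet A → (∀ γ, μ (symmDiff ((a γ : X → X) ⁻¹' A) A) = 0) →
    μ A = 0 ∨ μ A = 1

/-- Greedy exhaustion: starting from `(A, B)`, at time `n` remove from the first set the points
that `f n` maps into the second one, and remove their images from the second set. -/
def greedyRemainder {X : Type*} (f : ℕ → Equiv.Perm X) (A B : Set X) : ℕ → Set X × Set X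
  | 0 => (A, B)
  | n + 1 =>
    ((greedyRemainder f A B n).1 \ f n ⁻¹' (greedyRemainder f A B n).2,
      (greedyRemainder f A B n).2 \ (f n).symm ⁻¹' (greedyRemainder f A B n).1)

/-- The points of `A` matched at time `n` of the greedy exhaustion. -/
def greedyDomain {X : Type*} (f : ℕ → Equiv.Perm X) (A B : Set X) (n : ℕ) : Set X :=
  (greedyRemainder f A B n).1 ∩ f n ⁻¹' (greedyRemainder f A B n).2

/-- The points of `B` matched at time `n` of the greedy exhaustion. -/
def greedyRange {X : Type*} (f : ℕ → Equiv.Perm X) (A B : Set X) (n : ℕ) : Set X :=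
  (greedyRemainder f A B n).2 ∩ (f n).symm ⁻¹' (greedyRemainder f A B n).1

section Greedy

open Set

variable {X : Type*} (f : ℕ → Equiv.Perm X) (A B : Set X)

theorem antitone_greedyRemainder : Antitone (greedyRemainder f A B) :=
  antitone_nat_of_succ_le fun _ => ⟨sdiff_subset, sdiff_subset⟩

theorem greedyDomain_subset (n : ℕ) : greedyDomain f A B n ⊆ A :=
  inter_subset_left.trans (antitone_greedyRemainder f A B n.zero_le).1

theorem greedyRange_subset (n : ℕ) : greedyRange f A B n ⊆ B :=
  inter_subset_left.trans (antitone_greedyRemainder f A B n.zero_le).2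

theorem apply_mem_greedyRange_iff {n : ℕ} {x : X} :
    f n x ∈ greedyRange f A B n ↔ x ∈ greedyDomain f A B n := by
  simp [greedyRange, greedyDomain, and_comm]

theorem pairwise_disjoint_greedyDomain :
    Pairwise (Function.onFun Disjoint (greedyDomain f A B)) := by
  refine (pairwise_disjoint_on _).2 fun m n hmn => disjoint_left.2 fun x hm hn => ?_
  exact ((antitone_greedyRemainder f A B (Nat.succ_le_of_lt hmn)).1 hn.1).2 hm.2

theorem pairwise_disjoint_greedyRange :
    Pairwise (Function.onFun Disjoint (greedyRange f A B)) := by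
  refine (pairwise_disjoint_on _).2 fun m n hmn => disjoint_left.2 fun x hm hn => ?_
  exact ((antitone_greedyRemainder f A B (Nat.succ_le_of_lt hmn)).2 hn.1).2 hm.2

theorem diff_iUnion_greedyDomain_subset (n : ℕ) :
    A \ ⋃ k, greedyDomain f A B k ⊆ (greedyRemainder f A B n).1 := by
  rintro x ⟨hx, hxn⟩
  induction n with
  | zero => exact hx
  | succ n ih => exact ⟨ih, fun h => hxn (mem_iUnion.2 ⟨n, ih, h⟩)⟩

theorem diff_iUnion_greedyRange_subset (n : ℕ) :
    B \ ⋃ k, greedyRange f A B k ⊆ (greedyRemainder f A B n).2 := by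
  rintro x ⟨hx, hxn⟩
  induction n with
  | zero => exact hx
  | succ n ih => exact ⟨ih, fun h => hxn (mem_iUnion.2 ⟨n, ih, h⟩)⟩

/-- Nothing is left to be matched after the greedy exhaustion. -/
theorem apply_notMem_diff_iUnion_greedyRange (n : ℕ) {x : X}
    (hx : x ∈ A \ ⋃ k, greedyDomain f A B k) :
    f n x ∉ B \ ⋃ k, greedyRange f A B k := fun h =>
  hx.2 (mem_iUnion.2 ⟨n, diff_iUnion_greedyDomain_subset f A B n hx,
    diff_iUnion_greedyRange_subset f A B n h⟩)

variable [MeasurableSpace X] {f A B}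

theorem measurableSet_greedyRemainder (hf : ∀ n, Measurable (f n))
    (hg : ∀ n, Measurable (f n).symm) (hA : MeasurableSet A) (hB : MeasurableSet B) (n : ℕ) :
    MeasurableSet (greedyRemainder f A B n).1 ∧ MeasurableSet (greedyRemainder f A B n).2 := by
  induction n with
  | zero => exact ⟨hA, hB⟩
  | succ n ih => exact ⟨ih.1.diff (hf n ih.2), ih.2.diff (hg n ih.1)⟩

end Greedy

/-- If no element of the group moves a point of `U` into `V`, where the action is ergodic, then
one of `U` and `V` is null. -/
theorem ErgodicAction.measure_eq_zero_or_of_disjoint {X Γ : Type*} [MeasurableSpace X] [Group Γ]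
    [Countable Γ] {μ : Measure X} [IsProbabilityMeasure μ] {a : Γ →* Equiv.Perm X}
    (herg : ErgodicAction μ a) (ha : ∀ γ, Measurable (a γ)) {U V : Set X} (hV : MeasurableSet V)
    (h : ∀ γ, ∀ x ∈ U, a γ x ∉ V) : μ U = 0 ∨ μ V = 0 := by
  have hS : MeasurableSet (⋃ γ, a γ ⁻¹' V) := .iUnion fun γ => ha γ hV
  have hVS : V ⊆ ⋃ γ, a γ ⁻¹' V := fun x hx => Set.mem_iUnion.2 ⟨1, by simpa using hx⟩
  have hinv (γ : Γ) : a γ ⁻¹' (⋃ γ, a γ ⁻¹' V) = ⋃ γ, a γ ⁻¹' V := by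
    ext x
    simp only [Set.mem_preimage, Set.mem_iUnion, ← Equiv.Perm.mul_apply, ← map_mul]
    exact (Equiv.mulRight γ).exists_congr_left.trans (by simp)
  rcases herg _ hS fun γ => by simp [hinv γ] with h0 | h1
  · exact .inr (measure_mono_null hVS h0)
  · refine .inl (measure_mono_null (Set.subset_compl_iff_disjoint_right.2 ?_)
      ((prob_compl_eq_zero_iff hS).2 h1))
    refine Set.disjoint_left.2 fun x hx hxS => ?_
    obtain ⟨γ, hγ⟩ := Set.mem_iUnion.1 hxS
    exact h γ x hx hγ

/-- If a countable group acts ergodically by m.p. transformations and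
`μ(A) = μ(A') > 0`, then there is a measure-preserving measurable bijection `φ` from a
conull subset of `A` onto a conull subset of `A'` whose graph is contained in the orbit
equivalence relation `E_Γ`. -/
theorem exists_partial_morphism_in_full_pseudogroup
    {X : Type} [TopologicalSpace X] [PolishSpace X] [MeasurableSpace X] [BorelSpace X]
    (μ : Measure X) [IsProbabilityMeasure μ]
    (Γ : Type) [Group Γ] [Countable Γ] (a : Γ →* Equiv.Perm X)
    (hmp : ∀ γ, IsMpt μ (a γ)) (herg : ErgodicAction μ a)
    (A A' : Set X) (hA : MeasurableSet A) (hA' : MeasurableSet A')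
    (hμ : μ A = μ A') (hpos : 0 < μ A) :
    ∃ (A₀ A₀' : Set X) (φ : X → X),
      MeasurableSet A₀ ∧ MeasurableSet A₀' ∧
      A₀ ⊆ A ∧ A₀' ⊆ A' ∧ μ (A \ A₀) = 0 ∧ μ (A' \ A₀') = 0 ∧
      Measurable φ ∧ Set.BijOn φ A₀ A₀' ∧
      (∀ B : Set X, MeasurableSet B → B ⊆ A₀' → μ (A₀ ∩ φ ⁻¹' B) = μ B) ∧
      (∀ x ∈ A₀, ∃ γ : Γ, a γ x = φ x) := by
  obtain ⟨e, he⟩ := exists_surjective_nat Γ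
  let f : ℕ → Equiv.Perm X := fun n => a (e n)
  have hf (n : ℕ) : Measurable (f n) := (hmp (e n)).1
  have hR := measurableSet_greedyRemainder hf (fun n => (hmp (e n)).2.1) hA hA'
  let P := greedyDomain f A A'
  let Q := greedyRange f A A'
  have hP (n : ℕ) : MeasurableSet (P n) := (hR n).1.inter (hf n (hR n).2)
  have hQ (n : ℕ) : MeasurableSet (Q n) := (hR n).2.inter ((hmp (e n)).2.1 (hR n).1)
  have hPd := pairwise_disjoint_greedyDomain f A A'
  have hQd := pairwise_disjoint_greedyRange f A A'
  obtain ⟨φ, hφ, hφf⟩ := exists_measurable_piecewise P hP (fun n => f n) hf fun i j hij x hx =>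
    (Set.disjoint_left.1 (hPd hij) hx.1 hx.2).elim
  have hPA : ⋃ n, P n ⊆ A := Set.iUnion_subset (greedyDomain_subset f A A')
  have hQA : ⋃ n, Q n ⊆ A' := Set.iUnion_subset (greedyRange_subset f A A')
  have hPm : MeasurableSet (⋃ n, P n) := .iUnion hP
  have hQm : MeasurableSet (⋃ n, Q n) := .iUnion hQ
  have hbij : Set.BijOn φ (⋃ n, P n) (⋃ n, Q n) := by
    refine ⟨fun x hx => ?_, fun x hx y hy hxy => ?_, fun y hy => ?_⟩
    · obtain ⟨n, hn⟩ := Set.mem_iUnion.1 hx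
      exact Set.mem_iUnion.2 ⟨n, hφf n hn ▸ (apply_mem_greedyRange_iff f A A').2 hn⟩
    · obtain ⟨m, hm⟩ := Set.mem_iUnion.1 hx
      obtain ⟨n, hn⟩ := Set.mem_iUnion.1 hy
      rw [hφf m hm, hφf n hn] at hxy
      have hm' := (apply_mem_greedyRange_iff f A A').2 hm
      have hn' := (apply_mem_greedyRange_iff f A A').2 hn
      rw [hxy] at hm'
      obtain rfl : m = n := by
        by_contra hmn
        exact Set.disjoint_left.1 (hQd hmn) hm' hn'
      exact (f m).injective hxy
    · obtain ⟨n, hn⟩ := Set.mem_iUnion.1 hy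
      have hx : (f n).symm y ∈ P n := (apply_mem_greedyRange_iff f A A').1 (by simpa using hn)
      exact ⟨_, Set.mem_iUnion.2 ⟨n, hx⟩, by simp [hφf n hx]⟩
  have hpres (B : Set X) (hB : MeasurableSet B) (hBQ : B ⊆ ⋃ n, Q n) :
      μ ((⋃ n, P n) ∩ φ ⁻¹' B) = μ B := by
    nth_rw 2 [← Set.inter_eq_right.2 hBQ]
    rw [Set.iUnion_inter, Set.iUnion_inter,
      measure_iUnion (fun i j hij => (hPd hij).mono Set.inter_subset_left Set.inter_subset_left)
        fun n => (hP n).inter (hφ hB),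
      measure_iUnion (fun i j hij => (hQd hij).mono Set.inter_subset_left Set.inter_subset_left)
        fun n => (hQ n).inter hB]
    refine tsum_congr fun n => ?_
    rw [← (hmp (e n)).2.2.measure_preimage ((hQ n).inter hB).nullMeasurableSet]
    congr 1
    ext x
    refine (and_congr_right fun hx => ?_).trans
      (and_congr_left' (apply_mem_greedyRange_iff f A A').symm)
    rw [Set.mem_preimage, hφf n hx]
  have hPQ : μ (⋃ n, P n) = μ (⋃ n, Q n) := by
    rw [← hpres _ hQm le_rfl, Set.inter_eq_left.2 hbij.mapsTo.subset_preimage]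
  have hrest : μ (A \ ⋃ n, P n) = μ (A' \ ⋃ n, Q n) := by
    rw [measure_sdiff hPA hPm.nullMeasurableSet (measure_ne_top _ _),
      measure_sdiff hQA hQm.nullMeasurableSet (measure_ne_top _ _), hμ, hPQ]
  have hnull : μ (A \ ⋃ n, P n) = 0 :=
    (herg.measure_eq_zero_or_of_disjoint (fun γ => (hmp γ).1) (hA'.diff hQm)
      (he.forall.2 fun n x hx => apply_notMem_diff_iUnion_greedyRange f A A' n hx)).elim id
      hrest.trans
  refine ⟨⋃ n, P n, ⋃ n, Q n, φ, hPm, hQm, hPA, hQA, hnull, hrest ▸ hnull, hφ, hbij, hpres,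
    fun x hx => ?_⟩
  obtain ⟨n, hn⟩ := Set.mem_iUnion.1 hx
  exact ⟨e n, (hφf n hn).symm⟩
end

section
/- Let X be a Polish space with a Borel probability measure μ and a compatible complete metric d, and let (O_m)_{m∈ℕ} be a countable basis for the topology of X closed under finite unions. Define, for measure-preserving transformations S, T of X, d_w(S,T) = Σ_m 2^{−m}[μ(S(O_m) Δ T(O_m)) + μ(S⁻¹(O_m) Δ T⁻¹(O_m))]. If S and (S_n)_{n∈ℕ} are measure-preserving transformations with d_w(S_n,S) < 2^{−n} for every n, then S_n(x) → S(x) for almost every x ∈ X. -/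
open MeasureTheory Filter ENNReal

/-- The weak "metric" `d_w(S,T) = Σ_m 2^{-m} [μ(S(O_m) Δ T(O_m)) + μ(S⁻¹(O_m) Δ T⁻¹(O_m))]`
associated to a countable basis `(O_m)` (values in `ℝ≥0∞`). -/
noncomputable def dw {X : Type*} [MeasurableSpace X] (μ : Measure X) (O : ℕ → Set X)
    (S T : Equiv.Perm X) : ℝ≥0∞ :=
  ∑' m, (2 : ℝ≥0∞)⁻¹ ^ m *
    (μ (symmDiff ((S : X → X) '' O m) ((T : X → X) '' O m)) +
     μ (symmDiff ((S : X → X) ⁻¹' O m) ((T : X → X) ⁻¹' O m)))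

theorem measure_symmDiff_preimage_le_dw {X : Type*} [MeasurableSpace X] (μ : Measure X)
    (O : ℕ → Set X) (S T : Equiv.Perm X) (m : ℕ) :
    μ (symmDiff ((S : X → X) ⁻¹' O m) ((T : X → X) ⁻¹' O m)) ≤ 2 ^ m * dw μ O S T := by
  have h : (2 : ℝ≥0∞)⁻¹ ^ m * μ (symmDiff ((S : X → X) ⁻¹' O m) ((T : X → X) ⁻¹' O m)) ≤
      dw μ O S T :=
    (mul_le_mul_right le_add_self _).trans (ENNReal.le_tsum m)
  rwa [← ENNReal.inv_pow, ENNReal.inv_mul_le_iff (by simp) (by simp)] at h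

/-- Borel-Cantelli: if `dw μ O (Sn n) S` is summable, then for almost every `x` and every `m`,
eventually `Sn n x` lies in `O m` exactly when `S x` does. -/
theorem ae_forall_eventually_mem_iff_of_tsum_dw_ne_top {X : Type*} [MeasurableSpace X]
    (μ : Measure X) (O : ℕ → Set X) (S : Equiv.Perm X) (Sn : ℕ → Equiv.Perm X)
    (h : ∑' n, dw μ O (Sn n) S ≠ ∞) :
    ∀ᵐ x ∂μ, ∀ m, ∀ᶠ n in atTop, Sn n x ∈ O m ↔ S x ∈ O m := by
  refine ae_all_iff.2 fun m => ?_
  have hfin : ∑' n, μ (symmDiff ((Sn n : X → X) ⁻¹' O m) ((S : X → X) ⁻¹' O m)) ≠ ∞ := by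
    refine ne_top_of_le_ne_top ?_
      (ENNReal.tsum_le_tsum fun n => measure_symmDiff_preimage_le_dw μ O (Sn n) S m)
    rw [ENNReal.tsum_mul_left]
    exact ENNReal.mul_ne_top (by simp) h
  filter_upwards [ae_eventually_notMem hfin] with x hx
  filter_upwards [hx] with n hn
  simp only [Set.mem_symmDiff, Set.mem_preimage] at hn
  tauto

/-- Proposition 3: if `(O_m)` is a countable basis closed under finite unions and
`d_w(S_n, S) < 2^{-n}` for all `n`, then `S_n(x) → S(x)` almost everywhere. -/
theorem ae_tendsto_of_summable_weak_distance
    {X : Type} [MetricSpace X] [PolishSpace X] [MeasurableSpace X] [BorelSpace X]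
    (μ : Measure X) [IsProbabilityMeasure μ]
    (O : ℕ → Set X) (hbasis : TopologicalSpace.IsTopologicalBasis (Set.range O))
    (hunion : ∀ m m', ∃ m'', O m'' = O m ∪ O m')
    (S : Equiv.Perm X) (hS : IsMpt μ S)
    (Sn : ℕ → Equiv.Perm X) (hSn : ∀ n, IsMpt μ (Sn n))
    (hclose : ∀ n, dw μ O (Sn n) S < (2 : ℝ≥0∞)⁻¹ ^ n) :
    ∀ᵐ x ∂μ, Tendsto (fun n => Sn n x) atTop (nhds (S x)) := by
  have hsum : ∑' n, dw μ O (Sn n) S ≠ ∞ := by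
    refine ne_top_of_le_ne_top ?_ (ENNReal.tsum_le_tsum fun n => (hclose n).le)
    simp [ENNReal.tsum_geometric]
  filter_upwards [ae_forall_eventually_mem_iff_of_tsum_dw_ne_top μ O S Sn hsum] with x hx
  refine (hbasis.nhds_hasBasis.tendsto_right_iff).2 ?_
  rintro _ ⟨⟨m, rfl⟩, hSx⟩
  filter_upwards [hx m] with n hn using hn.2 hSx
end

section
/- Let T_a, T_b, S be measure-preserving transformations of a standard Borel probability space (X,μ) generating an a.e. free action of the free group F₃, and let E_S be the induced orbit equivalence relation. Let Y = X × {0,1} with the measure μ × (uniform measure on {0,1}), let τ(x,i) = (x,1−i), and for a transformation R of X let R̃(x,0) = (R(x),0), R̃(x,1) = (x,1). Define T₀ and T₁ on Y by: T₀(x,0) = τ(x,0) and T₀(x,1) = T̃_a(τ(x,1)); T₁(x,0) = τ(S̃(x,0)) and T₁(x,1) = T̃_b(τ(x,1)). Then T₀ and T₁ generate the equivalence relation Ẽ_S on Y generated by T̃_a, T̃_b, S̃ and τ, and the group generated by T₀ and T₁ induces an almost everywhere free measure-preserving action of the free group F₂ on Y. -/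
open MeasureTheory

/-- The uniform probability measure on `{0,1} = Bool`. -/
noncomputable def unifBool : Measure Bool := (2 : ENNReal)⁻¹ • Measure.count

/-- The flip `τ(x, i) = (x, 1 − i)` on `X × {0,1}`. -/
def tauFlip (X : Type*) : Equiv.Perm (X × Bool) :=
  (Equiv.refl X).prodCongr ⟨Bool.not, Bool.not, Bool.not_not, Bool.not_not⟩

/-- The extension `R̃` of a transformation `R`: `R̃(x,0) = (R x, 0)`, `R̃(x,1) = (x,1)`. -/
def tilde {X : Type*} (S : Equiv.Perm X) : Equiv.Perm (X × Bool) where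
  toFun p := if p.2 then p else (S p.1, false)
  invFun p := if p.2 then p else (S.symm p.1, false)
  left_inv p := by rcases p with ⟨x, b⟩; cases b <;> simp
  right_inv p := by rcases p with ⟨x, b⟩; cases b <;> simp

/-- `T₀(x,0) = τ(x,0)`, `T₀(x,1) = T̃_a(τ(x,1))`. -/
def T0 {X : Type*} (Ta : Equiv.Perm X) : Equiv.Perm (X × Bool) where
  toFun p := if p.2 then (Ta p.1, false) else (p.1, true)
  invFun p := if p.2 then (p.1, false) else (Ta.symm p.1, true)
  left_inv p := by rcases p with ⟨x, b⟩; cases b <;> simp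
  right_inv p := by rcases p with ⟨x, b⟩; cases b <;> simp

/-- `T₁(x,0) = τ(S̃(x,0))`, `T₁(x,1) = T̃_b(τ(x,1))`. -/
def T1 {X : Type*} (Tb S : Equiv.Perm X) : Equiv.Perm (X × Bool) where
  toFun p := if p.2 then (Tb p.1, false) else (S p.1, true)
  invFun p := if p.2 then (S.symm p.1, false) else (Tb.symm p.1, true)
  left_inv p := by rcases p with ⟨x, b⟩; cases b <;> simp
  right_inv p := by rcases p with ⟨x, b⟩; cases b <;> simp

/-- The equivalence relation on `Y` generated by a set of transformations: the orbit
relation of the subgroup they generate. -/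
def genRel {Y : Type*} (Ts : Set (Equiv.Perm Y)) (p q : Y) : Prop :=
  ∃ g ∈ Subgroup.closure Ts, g p = q

theorem genRel_refl {Y : Type*} (Ts : Set (Equiv.Perm Y)) (p : Y) : genRel Ts p p :=
  ⟨1, one_mem _, rfl⟩

theorem genRel_symm {Y : Type*} {Ts : Set (Equiv.Perm Y)} {p q : Y}
    (h : genRel Ts p q) : genRel Ts q p := by
  obtain ⟨g, hg, rfl⟩ := h
  exact ⟨g⁻¹, inv_mem hg, by simp⟩

theorem genRel_trans {Y : Type*} {Ts : Set (Equiv.Perm Y)} {p q r : Y}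
    (h : genRel Ts p q) (h' : genRel Ts q r) : genRel Ts p r := by
  obtain ⟨g, hg, rfl⟩ := h
  obtain ⟨k, hk, rfl⟩ := h'
  exact ⟨k * g, mul_mem hk hg, rfl⟩

theorem genRel_apply {Y : Type*} {Ts : Set (Equiv.Perm Y)} {g : Equiv.Perm Y}
    (hg : g ∈ Ts) (p : Y) : genRel Ts p (g p) :=
  ⟨g, Subgroup.subset_closure hg, rfl⟩

theorem genRel_mono_of_generators {Y : Type*} {Ts Rs : Set (Equiv.Perm Y)}
    (h : ∀ g ∈ Ts, ∀ p, genRel Rs p (g p)) {p q : Y} (hpq : genRel Ts p q) :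
    genRel Rs p q := by
  obtain ⟨g, hg, rfl⟩ := hpq
  induction hg using Subgroup.closure_induction generalizing p with
  | mem g hg => exact h g hg p
  | one => exact genRel_refl Rs p
  | mul g k _ _ ihg ihk => exact genRel_trans ihk ihg
  | inv g _ ih => simpa using genRel_symm (ih (p := g⁻¹ p))

theorem T0_eq_mul {X : Type*} (Ta : Equiv.Perm X) : T0 Ta = tilde Ta * tauFlip X := by
  ext1 ⟨x, b⟩
  cases b <;> simp [T0, tilde, tauFlip]

theorem T1_eq_mul {X : Type*} (Tb S : Equiv.Perm X) :
    T1 Tb S = tilde Tb * (tauFlip X * tilde S) := by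
  ext1 ⟨x, b⟩
  cases b <;> simp [T1, tilde, tauFlip]

theorem genRel_T0_T1_iff {X : Type*} (Ta Tb S : Equiv.Perm X) (p q : X × Bool) :
    genRel {T0 Ta, T1 Tb S} p q ↔
      genRel {tauFlip X, tilde Ta, tilde Tb, tilde S} p q := by
  constructor
  · refine genRel_mono_of_generators ?_
    rintro g (rfl | rfl) p
    · rw [T0_eq_mul]
      exact genRel_trans (genRel_apply (g := tauFlip X) (by simp) p)
        (genRel_apply (g := tilde Ta) (by simp) _)
    · rw [T1_eq_mul]
      exact genRel_trans (genRel_trans (genRel_apply (g := tilde S) (by simp) p)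
        (genRel_apply (g := tauFlip X) (by simp) _)) (genRel_apply (g := tilde Tb) (by simp) _)
  · have h0 := genRel_apply (Ts := {T0 Ta, T1 Tb S}) (g := T0 Ta) (.inl rfl)
    have h1 := genRel_apply (Ts := {T0 Ta, T1 Tb S}) (g := T1 Tb S) (.inr rfl)
    have hflip (x : X) : genRel {T0 Ta, T1 Tb S} (x, false) (x, true) := h0 (x, false)
    refine genRel_mono_of_generators ?_
    rintro g (rfl | rfl | rfl | rfl) ⟨x, _ | _⟩
    · exact hflip x
    · exact genRel_symm (hflip x)
    · exact genRel_trans (hflip x) (h0 (x, true))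
    · exact genRel_refl _ _
    · exact genRel_trans (hflip x) (h1 (x, true))
    · exact genRel_refl _ _
    · exact genRel_trans (h1 (x, false)) (genRel_symm (hflip (S x)))
    · exact genRel_refl _ _

theorem IsMpt.mul {X : Type*} [MeasurableSpace X] {μ : Measure X} {R S : Equiv.Perm X}
    (hR : IsMpt μ R) (hS : IsMpt μ S) : IsMpt μ (R * S) :=
  ⟨hR.1.comp hS.1, hS.2.1.comp hR.2.1, hR.2.2.comp hS.2.2⟩

instance isFiniteMeasure_unifBool : IsFiniteMeasure unifBool :=
  ⟨by simp [unifBool, ENNReal.mul_lt_top_iff]⟩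

theorem prod_unifBool_apply {X : Type*} [MeasurableSpace X] (μ : Measure X) [SFinite μ]
    {A : Set (X × Bool)} (hA : MeasurableSet A) :
    (μ.prod unifBool) A =
      2⁻¹ * (μ ((fun x => (x, true)) ⁻¹' A) + μ ((fun x => (x, false)) ⁻¹' A)) := by
  rw [Measure.prod_apply_symm hA, unifBool, lintegral_smul_measure, lintegral_count,
    tsum_fintype, Fintype.sum_bool, smul_eq_mul]

theorem isMpt_tauFlip {X : Type*} [MeasurableSpace X] (μ : Measure X) [SFinite μ] :
    IsMpt (μ.prod unifBool) (tauFlip X) := by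
  have hm : Measurable (tauFlip X) :=
    measurable_fst.prodMk ((measurable_of_countable Bool.not).comp measurable_snd)
  refine ⟨hm, hm, hm, Measure.ext fun A hA => ?_⟩
  rw [Measure.map_apply hm hA, prod_unifBool_apply μ hA, prod_unifBool_apply μ (hm hA), add_comm]
  rfl

theorem measurable_tilde {X : Type*} [MeasurableSpace X] {S : Equiv.Perm X}
    (hS : Measurable S) : Measurable (tilde S) :=
  Measurable.ite (measurable_snd (measurableSet_singleton true)) measurable_id
    ((hS.comp measurable_fst).prodMk measurable_const)

theorem isMpt_tilde {X : Type*} [MeasurableSpace X] {μ : Measure X} [SFinite μ]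
    {S : Equiv.Perm X} (hS : IsMpt μ S) : IsMpt (μ.prod unifBool) (tilde S) := by
  have hm := measurable_tilde hS.1
  refine ⟨hm, measurable_tilde hS.2.1, hm, Measure.ext fun A hA => ?_⟩
  rw [Measure.map_apply hm hA, prod_unifBool_apply μ hA, prod_unifBool_apply μ (hm hA),
    ← hS.2.2.measure_preimage 
      (s := (fun x => (x, false)) ⁻¹' A) (measurable_prodMk_right hA).nullMeasurableSet]
  rfl

/-- The homomorphism `F₃ → F₂` sending `a ↦ t₀²`, `b ↦ t₁t₀`, `s ↦ t₀⁻¹t₁`; it is inverse to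
the identification of the index-two subgroup of even words of `F₂` with `F₃`. -/
def evenWordHom : FreeGroup (Fin 3) →* FreeGroup (Fin 2) :=
  FreeGroup.lift ![.of 0 * .of 0, .of 1 * .of 0, (.of 0)⁻¹ * .of 1]

/-- Coset representatives of the subgroup of even words in `F₂`. -/
def evenWordRep (i : Bool) : FreeGroup (Fin 2) := if i then .of 0 else 1

theorem lift_T0_T1_apply {X : Type*} (Ta Tb S : Equiv.Perm X) (w : FreeGroup (Fin 2))
    (i : Bool) :
    ∃ (g : FreeGroup (Fin 3)) (j : Bool),
      evenWordHom g = (evenWordRep j)⁻¹ * w * evenWordRep i ∧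
      ∀ x, FreeGroup.lift ![T0 Ta, T1 Tb S] w (x, i) =
        (FreeGroup.lift ![Ta, Tb, S] g x, j) := by
  induction w using FreeGroup.induction_on generalizing i with
  | C1 => exact ⟨1, i, by simp, by simp⟩
  | of k =>
    fin_cases k <;> cases i
    · exact ⟨1, true, by simp [evenWordRep], by simp [T0]⟩
    · exact ⟨.of 0, false, by simp [evenWordRep, evenWordHom], by simp [T0]⟩
    · exact ⟨.of 2, true, by simp [evenWordRep, evenWordHom], by simp [T1]⟩
    · exact ⟨.of 1, false, by simp [evenWordRep, evenWordHom], by simp [T1]⟩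
  | inv_of k _ =>
    fin_cases k <;> cases i
    · exact ⟨(.of 0)⁻¹, true, by simp [evenWordRep, evenWordHom],
        by simp [T0, Equiv.Perm.inv_def]⟩
    · exact ⟨1, false, by simp [evenWordRep], by simp [T0, Equiv.Perm.inv_def]⟩
    · exact ⟨(.of 1)⁻¹, true, by simp [evenWordRep, evenWordHom],
        by simp [T1, Equiv.Perm.inv_def]⟩
    · exact ⟨(.of 2)⁻¹, false, by simp [evenWordRep, evenWordHom],
        by simp [T1, Equiv.Perm.inv_def]⟩
  | mul v w ihv ihw =>
    obtain ⟨g, j, hg, hgx⟩ := ihw i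
    obtain ⟨h, k, hh, hhx⟩ := ihv j
    exact ⟨h * g, k, by rw [map_mul, hh, hg]; group, fun x => by simp [hgx, hhx]⟩

theorem measure_fixedPoints_lift_T0_T1 {X : Type*} [MeasurableSpace X] (μ : Measure X)
    [SFinite μ] (Ta Tb S : Equiv.Perm X)
    (hfree : ∀ w : FreeGroup (Fin 3), w ≠ 1 →
      μ {x | FreeGroup.lift ![Ta, Tb, S] w x = x} = 0)
    (w : FreeGroup (Fin 2)) (hw : w ≠ 1) :
    (μ.prod unifBool) {p : X × Bool | FreeGroup.lift ![T0 Ta, T1 Tb S] w p = p} = 0 := by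
  have hnull (i : Bool) :
      μ {x | FreeGroup.lift ![T0 Ta, T1 Tb S] w (x, i) = (x, i)} = 0 := by
    obtain ⟨g, j, hg, hgx⟩ := lift_T0_T1_apply Ta Tb S w i
    simp only [hgx, Prod.mk.injEq]
    by_cases hij : j = i
    · subst hij
      have hg1 : g ≠ 1 := by
        rintro rfl
        rw [map_one] at hg
        refine hw ((conj_eq_one_iff (a := (evenWordRep j)⁻¹)).1 ?_)
        rw [inv_inv, ← hg]
      simpa using hfree g hg1
    · simp [hij]
  refine measure_mono_null (t := ⋃ i : Bool,
    {x | FreeGroup.lift ![T0 Ta, T1 Tb S] w (x, i) = (x, i)} ×ˢ {i}) ?_ ?_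
  · rintro ⟨x, i⟩ hx
    exact Set.mem_iUnion.2 ⟨i, hx, rfl⟩
  · exact measure_iUnion_null fun i => by rw [Measure.prod_prod, hnull, zero_mul]

/-- If `T_a, T_b, S` generate an a.e. free m.p. action of `F₃` on `(X, μ)`, then on
`Y = X × {0,1}` the transformations `T₀, T₁` generate the expanded equivalence relation
`Ẽ_S` (generated by `T̃_a, T̃_b, S̃, τ`), and they induce an a.e. free m.p. action of the
free group `F₂` on `Y`. -/
theorem expansion_generators_give_ae_free_F2_action
    {X : Type} [TopologicalSpace X] [PolishSpace X] [MeasurableSpace X] [BorelSpace X]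
    (μ : Measure X) [IsProbabilityMeasure μ]
    (Ta Tb S : Equiv.Perm X)
    (hTa : IsMpt μ Ta) (hTb : IsMpt μ Tb) (hS : IsMpt μ S)
    (hfree : ∀ w : FreeGroup (Fin 3), w ≠ 1 →
      μ {x | FreeGroup.lift ![Ta, Tb, S] w x = x} = 0) :
    (∀ p q : X × Bool,
      genRel {T0 Ta, T1 Tb S} p q ↔
      genRel {tauFlip X, tilde Ta, tilde Tb, tilde S} p q) ∧
    IsMpt (μ.prod unifBool) (T0 Ta) ∧
    IsMpt (μ.prod unifBool) (T1 Tb S) ∧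
    (∀ w : FreeGroup (Fin 2), w ≠ 1 →
      (μ.prod unifBool) {p : X × Bool | FreeGroup.lift ![T0 Ta, T1 Tb S] w p = p} = 0) := by
  exact ⟨genRel_T0_T1_iff Ta Tb S,
    T0_eq_mul Ta ▸ (isMpt_tilde hTa).mul (isMpt_tauFlip μ),
    T1_eq_mul Tb S ▸ (isMpt_tilde hTb).mul ((isMpt_tauFlip μ).mul (isMpt_tilde hS)),
    measure_fixedPoints_lift_T0_T1 μ Ta Tb S hfree⟩
end
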